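/- Let n ≥ 1, let X ⊂ ℝⁿ be open and bounded, let Y ⊂ ℝⁿ be open, bounded and convex, let a₀ ∈ ℝ and y₀ ∈ Y, and let 1 < q ≤ 2. Let γ : X → ℝ be Lipschitz continuous with γ(x) ≥ λ for all x ∈ X, for some constant λ > 0. Suppose u belongs to the admissible class U₀ and minimizes the Rochet–Choné functional with q-power cost L(v) = ∫_X ( |∇v(x)|^q/q − x·∇v(x) + v(x) ) γ(x) dx over U₀. Then u ∈ C^{1,1}_loc(X); that is, u is differentiable on X and ∇u is Lipschitz continuous on every compact subset of X. -/

import Mathlib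

open MeasureTheory RealInnerProductSpace

/-- The subdifferential of `v` at `x`, relative to the set `X`:
the set of `p` with `v z ≥ v x + ⟪p, z - x⟫` for all `z ∈ X`. -/
def subgrad {n : ℕ} (X : Set (EuclideanSpace ℝ (Fin n)))
    (v : EuclideanSpace ℝ (Fin n) → ℝ) (x : EuclideanSpace ℝ (Fin n)) :
    Set (EuclideanSpace ℝ (Fin n)) :=
  {p | ∀ z ∈ X, v x + ⟪p, z - x⟫ ≤ v z}

/-- The admissible class `U₀`: convex functions on `X` whose subdifferential lies in the
closure of `Y` and which dominate the affine function `x ↦ a₀ + x·y₀`. -/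
def admissible {n : ℕ} (X Y : Set (EuclideanSpace ℝ (Fin n))) (a₀ : ℝ)
    (y₀ : EuclideanSpace ℝ (Fin n)) (v : EuclideanSpace ℝ (Fin n) → ℝ) : Prop :=
  ConvexOn ℝ X v ∧ (∀ x ∈ X, subgrad X v x ⊆ closure Y) ∧
    ∀ x ∈ X, a₀ + ⟪x, y₀⟫ ≤ v x

/-- The Rochet–Choné functional with `q`-power cost,
`L(v) = ∫_X (|∇v|^q/q - x·∇v + v) γ dx`, where `∇v` is the (a.e. defined) gradient. -/
noncomputable def rochetChone {n : ℕ} (X : Set (EuclideanSpace ℝ (Fin n)))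
    (γ : EuclideanSpace ℝ (Fin n) → ℝ) (q : ℝ)
    (v : EuclideanSpace ℝ (Fin n) → ℝ) : ℝ :=
  ∫ x in X, (‖gradient v x‖ ^ q / q - ⟪x, gradient v x⟫ + v x) * γ x

section Convexity

variable {n : ℕ} {X Y : Set (EuclideanSpace ℝ (Fin n))} {u : EuclideanSpace ℝ (Fin n) → ℝ}

/-- A convex function on an open set has a subgradient at every point. -/
theorem ConvexOn.subgrad_nonempty (hX : IsOpen X) (hu : ConvexOn ℝ X u)
    {x : EuclideanSpace ℝ (Fin n)} (hx : x ∈ X) : (subgrad X u x).Nonempty := by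
  have hopen : IsOpen {p : EuclideanSpace ℝ (Fin n) × ℝ | p.1 ∈ X ∧ u p.1 < p.2} := by
    rw [isOpen_iff_mem_nhds]
    rintro ⟨a, t⟩ ⟨ha, hat⟩
    have hc : ContinuousAt (fun p : EuclideanSpace ℝ (Fin n) × ℝ => u p.1) (a, t) :=
      ContinuousAt.comp (f := Prod.fst) ((hu.continuousOn hX).continuousAt (hX.mem_nhds ha))
        continuousAt_fst
    filter_upwards [continuousAt_fst.preimage_mem_nhds (hX.mem_nhds ha),
      hc.eventually_lt continuousAt_snd hat] with p hp1 hp2 using ⟨hp1, hp2⟩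
  obtain ⟨f, hf⟩ := geometric_hahn_banach_open_point (x := (x, u x))
    hu.convex_strict_epigraph hopen (by simp)
  set g : StrongDual ℝ (EuclideanSpace ℝ (Fin n)) :=
    f.comp (ContinuousLinearMap.inl ℝ _ ℝ) with hg
  set s : ℝ := f (0, 1) with hs
  have hfd : ∀ z t, f (z, t) = g z + s * t := by
    intro z t
    have : (z, t) = ((z, 0) : EuclideanSpace ℝ (Fin n) × ℝ) + t • (0, 1) := by simp
    rw [this, map_add, map_smul, hg, hs]
    simp [mul_comm]
  have hs0 : s < 0 := by
    have := hf (x, u x + 1) ⟨hx, by simp⟩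
    rw [hfd, hfd] at this
    linarith
  have hle : ∀ z ∈ X, g z + s * u z ≤ g x + s * u x := by
    intro z hz
    refine le_of_forall_pos_le_add fun ε hε => ?_
    have := hf (z, u z + ε / (-s)) ⟨hz, by simpa using div_pos hε (neg_pos.2 hs0)⟩
    rw [hfd, hfd] at this
    have h2 : s * (ε / (-s)) = -ε := by
      have := hs0.ne
      field_simp
    linarith [mul_add s (u z) (ε / (-s))]
  refine ⟨(-s)⁻¹ • (InnerProductSpace.toDual ℝ _).symm g, fun z hz => ?_⟩
  rw [real_inner_smul_left, InnerProductSpace.toDual_symm_apply, map_sub]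
  have h1 := hle z hz
  have h2 : 0 < (-s)⁻¹ := inv_pos.2 (neg_pos.2 hs0)
  have h3 := mul_le_mul_of_nonneg_left h1 h2.le
  have h4 : (-s)⁻¹ * s = -1 := by field_simp [hs0.ne]
  linear_combination h3 + (u x - u z) * h4

/-- A convex function on an open set with bounded subgradients is Lipschitz. -/
theorem ConvexOn.lipschitzOnWith_of_subgrad_norm_le (hX : IsOpen X) (hu : ConvexOn ℝ X u)
    {M : NNReal} (hM : ∀ x ∈ X, ∀ p ∈ subgrad X u x, ‖p‖ ≤ M) : LipschitzOnWith M u X := by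
  refine LipschitzOnWith.of_le_add_mul M fun x hx y hy => ?_
  obtain ⟨p, hp⟩ := hu.subgrad_nonempty hX hx
  have h1 := hp y hy
  have h2 : -⟪p, y - x⟫ ≤ M * ‖y - x‖ :=
    (neg_le_abs _).trans ((abs_real_inner_le_norm _ _).trans
      (mul_le_mul_of_nonneg_right (hM x hx p hp) (norm_nonneg _)))
  rw [dist_comm, dist_eq_norm]
  linarith

/-- The maximum of an admissible function and an affine function with slope in the closure
of `Y` is admissible. -/
theorem admissible.sup_affine (hX : IsOpen X) (hYc : Convex ℝ Y) {a₀ : ℝ}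
    {y₀ : EuclideanSpace ℝ (Fin n)} (hu : admissible X Y a₀ y₀ u)
    {P : EuclideanSpace ℝ (Fin n)} (hP : P ∈ closure Y) (c : ℝ) :
    admissible X Y a₀ y₀ (fun x => max (u x) (c + ⟪P, x⟫)) := by
  obtain ⟨hc, hsub, hlow⟩ := hu
  have haff : ConvexOn ℝ X (fun x => c + ⟪P, x⟫) :=
    (convexOn_const c hc.1).add ((innerₛₗ ℝ P).convexOn hc.1)
  refine ⟨hc.sup haff, fun x hx p hp => ?_, fun x hx => (hlow x hx).trans (le_max_left _ _)⟩
  by_contra hpY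
  obtain ⟨f, m, hfY, hfp⟩ := geometric_hahn_banach_closed_point hYc.closure isClosed_closure hpY
  set d := (InnerProductSpace.toDual ℝ _).symm f with hd
  have hfd : ∀ z, f z = ⟪z, d⟫ := fun z => by
    rw [real_inner_comm, hd, InnerProductSpace.toDual_symm_apply]
  obtain ⟨t, ht, htX⟩ : ∃ t : ℝ, 0 < t ∧ x + t • d ∈ X := by
    have : Filter.Tendsto (fun t : ℝ => x + t • d) (nhdsWithin 0 (Set.Ioi 0)) (nhds x) := by
      have h : Continuous fun t : ℝ => x + t • d := by fun_prop
      simpa using (h.tendsto 0).mono_left nhdsWithin_le_nhds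
    obtain ⟨t, h1, h2⟩ := ((this.eventually (hX.mem_nhds hx)).and self_mem_nhdsWithin).exists
    exact ⟨t, h2, h1⟩
  obtain ⟨p', hp'⟩ := hc.subgrad_nonempty hX htX
  have h1 := hp' x hx
  have h2 := hp _ htX
  have h3 := hfY p' (hsub _ htX hp')
  have h4 := hfY P hP
  rw [hfd] at h3 h4 hfp
  simp only [sub_add_cancel_left, add_sub_cancel_left, inner_neg_right, inner_smul_right,
    inner_add_right] at h1 h2
  have h5 : t * ⟪p', d⟫ ≤ t * m := by gcongr
  have h6 : t * ⟪P, d⟫ ≤ t * m := by gcongr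
  have h7 : t * m < t * ⟪p, d⟫ := by gcongr
  have h8 : max (u (x + t • d)) (c + (⟪P, x⟫ + t * ⟪P, d⟫)) ≤
      max (u x) (c + ⟪P, x⟫) + t * m :=
    max_le (by linarith [le_max_left (u x) (c + ⟪P, x⟫)])
      (by linarith [le_max_right (u x) (c + ⟪P, x⟫)])
  linarith

end Convexity

section PowerCost

/-- Quantitative convexity of `s ↦ s ^ q / q` on `[0, M]` for `1 < q ≤ 2`. -/
theorem Real.rpow_div_strong_convex {q M s t : ℝ} (hq1 : 1 < q) (hq2 : q ≤ 2)
    (hs : s ∈ Set.Icc 0 M) (ht : t ∈ Set.Ioc 0 M) :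
    t ^ q / q + t ^ (q - 1) * (s - t) + (q - 1) / 2 * M ^ (q - 2) * (s - t) ^ 2 ≤ s ^ q / q := by
  have hM : 0 < M := ht.1.trans_le ht.2
  set κ := (q - 1) / 2 * M ^ (q - 2) with hκ
  set φ : ℝ → ℝ := fun s => s ^ q / q - κ * s ^ 2 with hφ
  have hq0 : q ≠ 0 := by linarith
  have hder : ∀ x, HasDerivAt φ (x ^ (q - 1) - κ * (2 * x)) x := by
    intro x
    have h1 := (Real.hasDerivAt_rpow_const (x := x) (p := q) (Or.inr hq1.le)).div_const q
    have h2 := (hasDerivAt_pow 2 x).const_mul κ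
    refine (h1.sub h2).congr_deriv ?_
    rw [mul_div_cancel_left₀ _ hq0]
    simp
  have hcont : Continuous φ := by
    rw [continuous_iff_continuousAt]
    exact fun x => (hder x).continuousAt
  have hconv : ConvexOn ℝ (Set.Icc 0 M) φ := by
    refine convexOn_of_hasDerivWithinAt2_nonneg (convex_Icc 0 M) hcont.continuousOn
      (f' := fun x => x ^ (q - 1) - κ * (2 * x))
      (f'' := fun x => (q - 1) * x ^ (q - 1 - 1) - κ * 2)
      (fun x _ => (hder x).hasDerivWithinAt) ?_ ?_
    · intro x hx
      rw [interior_Icc] at hx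
      have h1 := Real.hasDerivAt_rpow_const (x := x) (p := q - 1) (Or.inl hx.1.ne')
      have h2 := ((hasDerivAt_id x).const_mul 2).const_mul κ
      exact ((h1.sub h2).congr_deriv (by simp)).hasDerivWithinAt
    · intro x hx
      rw [interior_Icc] at hx
      have h1 : M ^ (q - 2) ≤ x ^ (q - 2) :=
        Real.rpow_le_rpow_of_nonpos hx.1 hx.2.le (by linarith)
      have h2 : q - 1 - 1 = q - 2 := by ring
      rw [h2, hκ]
      nlinarith
  have key : φ t + (t ^ (q - 1) - κ * (2 * t)) * (s - t) ≤ φ s := by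
    have htI : t ∈ Set.Icc 0 M := ⟨ht.1.le, ht.2⟩
    rcases lt_trichotomy s t with h | h | h
    · have := hconv.slope_le_of_hasDerivAt hs htI h (hder t)
      rw [slope_def_field, div_le_iff₀ (by linarith)] at this
      linarith
    · simp [h]
    · have := hconv.le_slope_of_hasDerivAt htI hs h (hder t)
      rw [slope_def_field, le_div_iff₀ (by linarith)] at this
      linarith
  simp only [hφ] at key
  nlinarith

/-- Quantitative convexity of `a ↦ ‖a‖ ^ q / q` on a ball for `1 < q ≤ 2`. -/
theorem norm_rpow_div_strong_convex {E : Type*} [NormedAddCommGroup E] [InnerProductSpace ℝ E]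
    {q M : ℝ} (hq1 : 1 < q) (hq2 : q ≤ 2) (hM : 0 < M) {a b : E} (ha : ‖a‖ ≤ M) (hb : ‖b‖ ≤ M) :
    ‖b‖ ^ q / q + ⟪‖b‖ ^ (q - 2) • b, a - b⟫ + (q - 1) / 2 * M ^ (q - 2) * ‖a - b‖ ^ 2
      ≤ ‖a‖ ^ q / q := by
  rcases eq_or_ne b 0 with rfl | hb0
  · have hq0 : q ≠ 0 := by linarith
    simp only [norm_zero, Real.zero_rpow hq0, zero_div, smul_zero, inner_zero_left, sub_zero,
      zero_add]
    rcases eq_or_ne a 0 with rfl | ha0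
    · simp [Real.zero_rpow hq0]
    have ha' : 0 < ‖a‖ := norm_pos_iff.2 ha0
    have h1 : M ^ (q - 2) ≤ ‖a‖ ^ (q - 2) := Real.rpow_le_rpow_of_nonpos ha' ha (by linarith)
    have h2 : ‖a‖ ^ q = ‖a‖ ^ (q - 2) * ‖a‖ ^ 2 := by
      rw [← Real.rpow_natCast, ← Real.rpow_add ha']; norm_num
    have h3 : (q - 1) / 2 ≤ 1 / q := by
      rw [div_le_div_iff₀ (by norm_num) (by linarith)]; nlinarith
    calc (q - 1) / 2 * M ^ (q - 2) * ‖a‖ ^ 2 ≤ 1 / q * ‖a‖ ^ (q - 2) * ‖a‖ ^ 2 := by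
          have : 0 < M ^ (q - 2) := Real.rpow_pos_of_pos hM _
          have : 0 < q := by linarith
          gcongr
      _ = ‖a‖ ^ q / q := by rw [h2]; ring
  · have hb' : 0 < ‖b‖ := norm_pos_iff.2 hb0
    have h1 := Real.rpow_div_strong_convex hq1 hq2 (s := ‖a‖) (t := ‖b‖) ⟨norm_nonneg a, ha⟩
      ⟨hb', hb⟩
    have h2 : ‖b‖ ^ (q - 1) = ‖b‖ ^ (q - 2) * ‖b‖ := by
      rw [← Real.rpow_add_one hb'.ne']; ring_nf
    have h3 : (q - 1) * M ^ (q - 2) ≤ ‖b‖ ^ (q - 2) := by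
      have : M ^ (q - 2) ≤ ‖b‖ ^ (q - 2) := Real.rpow_le_rpow_of_nonpos hb' hb (by linarith)
      have : 0 < M ^ (q - 2) := Real.rpow_pos_of_pos hM _
      nlinarith
    have h4 : ⟪b, a⟫ ≤ ‖b‖ * ‖a‖ := real_inner_le_norm b a
    rw [h2] at h1
    rw [real_inner_smul_left, inner_sub_right, real_inner_self_eq_norm_sq, norm_sub_sq_real,
      real_inner_comm b a]
    nlinarith [mul_nonneg (sub_nonneg.2 h3) (sub_nonneg.2 h4)]

end PowerCost

section IntegrationByParts

/-- The product of two Lipschitz functions is Lipschitz if one of them is bounded by `1` and the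
other one is bounded on its support. -/
theorem LipschitzWith.mul_of_bound {α : Type*} [PseudoMetricSpace α] {f g : α → ℝ}
    {Kf Kg C : NNReal} (hf : LipschitzWith Kf f)
    (hg : LipschitzWith Kg g) (hg1 : ∀ x, |g x| ≤ 1) (hfC : ∀ x, g x ≠ 0 → |f x| ≤ C) :
    LipschitzWith (C * Kg + Kf) (fun x => f x * g x) := by
  have key : ∀ x y, g x ≠ 0 →
      |f x * g x - f y * g y| ≤ (C * Kg + Kf) * dist x y := by
    intro x y hx
    have h1 := hf.dist_le_mul x y
    have h2 := hg.dist_le_mul x y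
    rw [Real.dist_eq] at h1 h2
    calc |f x * g x - f y * g y| = |f x * (g x - g y) + (f x - f y) * g y| := by ring_nf
      _ ≤ |f x| * |g x - g y| + |f x - f y| * |g y| := by
        rw [← abs_mul, ← abs_mul]; exact abs_add_le _ _
      _ ≤ C * (Kg * dist x y) + Kf * dist x y * 1 := by
        gcongr
        exacts [hfC x hx, hg1 y]
      _ = _ := by ring
  refine LipschitzWith.of_dist_le_mul fun x y => ?_
  rw [Real.dist_eq]
  push_cast
  by_cases hx : g x = 0
  · by_cases hy : g y = 0
    · simp only [hx, hy, mul_zero, sub_zero, abs_zero]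
      positivity
    · rw [abs_sub_comm, dist_comm]
      exact key y x hy
  · exact key x y hx

variable {E : Type*} [NormedAddCommGroup E] [NormedSpace ℝ E]

/-- An open convex set is the sublevel set `{G < 1}` of a Lipschitz function `G` which is
positively homogeneous around a given point of the set. -/
theorem exists_lipschitz_gauge_around {X : Set E} (hXo : IsOpen X) (hXc : Convex ℝ X) {x₀ : E}
    {δ : NNReal} (hδ : 0 < δ) (hball : Metric.ball x₀ δ ⊆ X) :
    ∃ G : E → ℝ, LipschitzWith δ⁻¹ G ∧ (∀ x, x ∈ X ↔ G x < 1) ∧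
      ∀ x, ∀ t : ℝ, 0 ≤ t → G (AffineMap.homothety x₀ t x) = t * G x := by
  set s : Set E := (fun y => x₀ + y) ⁻¹' X with hs
  have hsc : Convex ℝ s := hXc.translate_preimage_right x₀
  have hsball : Metric.ball (0 : E) δ ⊆ s := by
    intro y hy
    apply hball
    simpa [dist_eq_norm] using hy
  have hso : IsOpen s := hXo.preimage (by fun_prop)
  refine ⟨fun x => gauge s (x - x₀), ?_, fun x => ?_, fun x t ht => ?_⟩
  · have h1 := hsc.lipschitzWith_gauge hδ hsball
    have h2 := h1.comp ((LipschitzWith.id (α := E)).sub (LipschitzWith.const x₀))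
    simpa [Function.comp_def] using h2
  · have h := setOfPred_gauge_lt_one_eq_self_of_isOpen hsc
      (hsball (Metric.mem_ball_self (NNReal.coe_pos.2 hδ))) hso
    have h' : gauge s (x - x₀) < 1 ↔ x - x₀ ∈ s := Set.ext_iff.1 h (x - x₀)
    rw [h', hs]
    simp
  · rw [AffineMap.homothety_apply]
    simp only [vsub_eq_sub, vadd_eq_add, add_sub_cancel_right]
    rw [gauge_smul_of_nonneg ht, smul_eq_mul]

/-- The line derivative vanishes at a global minimum. -/
theorem lineDeriv_eq_zero_of_forall_le {f : E → ℝ} {x : E} (h : ∀ y, f x ≤ f y) (e : E) :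
    lineDeriv ℝ f x e = 0 := by
  have : IsLocalMin (fun t : ℝ => f (x + t • e)) 0 :=
    Filter.Eventually.of_forall fun t => by simpa using h _
  exact this.deriv_eq_zero

variable [MeasurableSpace E] [BorelSpace E] [FiniteDimensional ℝ E] (μ : Measure E)
  [μ.IsAddHaarMeasure]

/-- The part of a bounded convex set lying outside of its dilation is small. -/
theorem measureReal_diff_dilation_le {S : Set E} (hSc : Convex ℝ S)
    (hSfin : μ S ≠ ⊤) {x₀ : E} (hx₀ : x₀ ∈ S) {T : Set E} (hT : MeasurableSet T) (hTS : T ⊆ S)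
    {s : ℝ} (hs : s ∈ Set.Icc 0 1) (hdisj : ∀ x ∈ S, AffineMap.homothety x₀ s x ∉ T) :
    μ.real T ≤ (1 - s ^ Module.finrank ℝ E) * μ.real S := by
  set A := AffineMap.homothety x₀ s '' S with hA
  have hAS : A ⊆ S := by
    rintro _ ⟨x, hx, rfl⟩
    rw [AffineMap.homothety_eq_lineMap]
    exact hSc.lineMap_mem hx₀ hx hs
  have hAT : Disjoint A T := by
    rw [Set.disjoint_left]
    rintro _ ⟨x, hx, rfl⟩
    exact hdisj x hx
  have hAm : μ.real A = s ^ Module.finrank ℝ E * μ.real S := by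
    rw [Measure.real, hA, Measure.addHaar_image_homothety, ENNReal.toReal_mul,
      ENNReal.toReal_ofReal (abs_nonneg _), abs_of_nonneg (pow_nonneg hs.1 _), Measure.real]
  have h1 := measureReal_union (μ := μ) hAT hT (measure_ne_top_of_subset hAS hSfin)
    (measure_ne_top_of_subset hTS hSfin)
  have h2 : μ.real (A ∪ T) ≤ μ.real S := measureReal_mono (Set.union_subset hAS hTS) hSfin
  linarith

/-- A bound for the defect in the integration by parts formula on a bounded convex set `X`,
when one of the functions is nonnegative and has convex positivity set `S`. The constant only
depends on the size of a ball contained in `X` around a point of `S`. -/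
theorem abs_setIntegral_lineDeriv_mul_le {X : Set E} (hXo : IsOpen X) (hXc : Convex ℝ X)
    (hXb : Bornology.IsBounded X) {x₀ : E} {δ : NNReal} (hδ : 0 < δ)
    (hball : Metric.ball x₀ δ ⊆ X) {w β : E → ℝ} {Kw Kβ : NNReal} (hw : LipschitzWith Kw w)
    (hβ : LipschitzWith Kβ β) (hw0 : ∀ x, 0 ≤ w x) {S : Set E} (hS : S = {x ∈ X | 0 < w x})
    (hSc : Convex ℝ S) (hx₀ : x₀ ∈ S) {h B : ℝ} (hwh : ∀ x ∈ X, w x ≤ h)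
    (hβB : ∀ x ∈ S, |β x| ≤ B) {e : E} (he : ‖e‖ ≤ 1) :
    |∫ x in X, (β x * lineDeriv ℝ w x e + lineDeriv ℝ β x e * w x) ∂μ| ≤
      2 * Module.finrank ℝ E * B * h / δ * μ.real S := by
  obtain ⟨G, hGlip, hGX, hGhom⟩ := exists_lipschitz_gauge_around hXo hXc hδ hball
  have hGc := hGlip.continuous
  have hδ' : (0 : ℝ) < δ := NNReal.coe_pos.2 hδ
  have hSX : S ⊆ X := by rw [hS]; exact fun x hx => hx.1
  have hXfin : μ X ≠ ⊤ := hXb.measure_lt_top.ne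
  have hSfin : μ S ≠ ⊤ := measure_ne_top_of_subset hSX hXfin
  have hSm : MeasurableSet S := by
    rw [hS]
    exact hXo.measurableSet.inter (isOpen_lt continuous_const hw.continuous).measurableSet
  have hB0 : 0 ≤ B := (abs_nonneg _).trans (hβB x₀ hx₀)
  have hh0 : 0 ≤ h := (hw0 x₀).trans (hwh x₀ (hSX hx₀))
  have hlip : ∀ {f : E → ℝ} {K : NNReal}, LipschitzWith K f → ∀ x, |lineDeriv ℝ f x e| ≤ K := by
    intro f K hf x
    have := norm_lineDeriv_le_of_lipschitz ℝ hf (x₀ := x) (v := e)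
    rw [Real.norm_eq_abs] at this
    exact this.trans (mul_le_of_le_one_right K.2 he)
  have hoff : ∀ x ∈ X, x ∉ S → w x = 0 := by
    intro x hx hxS
    rw [hS] at hxS
    exact le_antisymm (not_lt.1 fun h => hxS ⟨hx, h⟩) (hw0 x)
  have hoff' : ∀ x ∈ X, x ∉ S → lineDeriv ℝ w x e = 0 := fun x hx hxS =>
    lineDeriv_eq_zero_of_forall_le (fun y => by rw [hoff x hx hxS]; exact hw0 y) e
  have hβw' : ∀ x ∈ X, |β x * lineDeriv ℝ w x e| ≤ B * Kw := by
    intro x hx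
    by_cases hxS : x ∈ S
    · rw [abs_mul]
      exact mul_le_mul (hβB x hxS) (hlip hw x) (abs_nonneg _) hB0
    · rw [hoff' x hx hxS, mul_zero, abs_zero]
      positivity
  have hβw : ∀ x ∈ X, |β x * w x| ≤ B * h := by
    intro x hx
    by_cases hxS : x ∈ S
    · rw [abs_mul, abs_of_nonneg (hw0 x)]
      exact mul_le_mul (hβB x hxS) (hwh x hx) (hw0 x) hB0
    · rw [hoff x hx hxS, mul_zero, abs_zero]
      positivity
  have hβ'w : ∀ x ∈ X, |lineDeriv ℝ β x e * w x| ≤ Kβ * h := by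
    intro x hx
    rw [abs_mul, abs_of_nonneg (hw0 x)]
    exact mul_le_mul (hlip hβ x) (hwh x hx) (hw0 x) Kβ.2
  set D := B * Kw + Kβ * h with hD
  have hD0 : 0 ≤ D := by positivity
  have hmw := measurable_lineDeriv (𝕜 := ℝ) (v := e) hw.continuous
  have hmβ := measurable_lineDeriv (𝕜 := ℝ) (v := e) hβ.continuous
  have hcw := hw.continuous.measurable
  have hcβ := hβ.continuous.measurable
  have hint : ∀ {f : E → ℝ} (C : ℝ), Measurable f → (∀ x ∈ X, |f x| ≤ C) →
      IntegrableOn f X μ := by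
    intro f C hf hC
    exact Measure.integrableOn_of_bounded (M := C) hXfin hf.aestronglyMeasurable
      ((ae_restrict_iff' hXo.measurableSet).2 (Filter.Eventually.of_forall hC))
  have main : ∀ ε ∈ Set.Ioo (0 : ℝ) (1 / 2),
      |∫ x in X, (β x * lineDeriv ℝ w x e + lineDeriv ℝ β x e * w x) ∂μ| ≤
      2 * Module.finrank ℝ E * B * h / δ * μ.real S +
        ε * (2 * Module.finrank ℝ E * D * μ.real S) := by
    rintro ε ⟨hε, hε2⟩
    set ζ : E → ℝ := fun x => max 0 (min 1 ((1 - G x) / ε - 1)) with hζ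
    have hζ0 : ∀ x, 0 ≤ ζ x := fun x => le_max_left _ _
    have hζ1 : ∀ x, ζ x ≤ 1 := fun x => max_le zero_le_one (min_le_left _ _)
    have hζabs : ∀ x, |ζ x| ≤ 1 := fun x => by rw [abs_of_nonneg (hζ0 x)]; exact hζ1 x
    have hζone : ∀ x, G x < 1 - 2 * ε → ζ x = 1 := by
      intro x hx
      have : 1 ≤ (1 - G x) / ε - 1 := by
        rw [le_sub_iff_add_le, le_div_iff₀ hε]; linarith
      simp only [hζ, min_eq_left this, max_eq_right zero_le_one]
    have hζzero : ∀ x, 1 - ε < G x → ζ x = 0 := by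
      intro x hx
      have : (1 - G x) / ε - 1 ≤ 0 := by
        rw [sub_nonpos, div_le_one hε]; linarith
      simp only [hζ]
      exact max_eq_left ((min_le_right _ _).trans this)
    set Kζ : NNReal := δ⁻¹ * (Real.toNNReal ε)⁻¹ with hKζ
    have hKζ' : (Kζ : ℝ) = (δ * ε)⁻¹ := by
      rw [hKζ]; push_cast; rw [Real.coe_toNNReal _ hε.le, mul_inv]
    have hζlip : LipschitzWith Kζ ζ := by
      refine LipschitzWith.const_max (LipschitzWith.const_min
        (LipschitzWith.of_dist_le_mul fun x y => ?_) 1) 0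
      have h1 := hGlip.dist_le_mul x y
      rw [hKζ', Real.dist_eq, mul_inv]
      rw [Real.dist_eq] at h1
      have h2 : (1 - G x) / ε - 1 - ((1 - G y) / ε - 1) = -(G x - G y) * ε⁻¹ := by ring
      rw [h2, abs_mul, abs_neg, abs_of_pos (inv_pos.2 hε)]
      calc |G x - G y| * ε⁻¹ ≤ ((δ⁻¹ : NNReal) * dist x y) * ε⁻¹ := by gcongr
        _ = _ := by push_cast; ring
    have hζX : ∀ x, x ∉ X → ζ x = 0 := fun x hx =>
      hζzero x (by have := not_lt.1 (mt (hGX x).2 hx); linarith)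
    have hζ'X : ∀ x, x ∉ X → lineDeriv ℝ ζ x e = 0 := by
      intro x hx
      exact lineDeriv_eq_zero_of_forall_le (fun y => by rw [hζX x hx]; exact hζ0 y) e
    have hmζ := measurable_lineDeriv (𝕜 := ℝ) (v := e) hζlip.continuous
    have hcζ := hζlip.continuous.measurable
    set T : Set E := S ∩ {x | 1 - 2 * ε ≤ G x} with hT
    have hTm : MeasurableSet T :=
      hSm.inter (isClosed_le continuous_const hGc).measurableSet
    have hTvol : μ.real T ≤ 2 * Module.finrank ℝ E * ε * μ.real S := by
      have h1 := measureReal_diff_dilation_le μ hSc hSfin hx₀ hTm Set.inter_subset_left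
        (s := 1 - 2 * ε) ⟨by linarith, by linarith⟩ (by
          intro x hx hxT
          have h2 : 1 - 2 * ε ≤ (1 - 2 * ε) * G x := by
            rw [← hGhom x _ (by linarith)]; exact hxT.2
          have h3 := (hGX x).1 (hSX hx)
          nlinarith)
      have h2 := one_add_mul_le_pow (a := -(2 * ε)) (by linarith) (Module.finrank ℝ E)
      refine h1.trans (mul_le_mul_of_nonneg_right ?_ measureReal_nonneg)
      rw [← sub_eq_add_neg] at h2
      linarith
    -- integration by parts against the cut-off function
    obtain ⟨C, hC⟩ : ∃ C : NNReal, ∀ x ∈ X, |β x| ≤ C := by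
      obtain ⟨C, hC⟩ := hXb.isCompact_closure.exists_bound_of_continuousOn
        hβ.continuous.continuousOn
      exact ⟨C.toNNReal, fun x hx => (hC x (subset_closure hx)).trans (Real.le_coe_toNNReal C)⟩
    have hβζ : LipschitzWith (C * Kζ + Kβ) (fun x => β x * ζ x) :=
      hβ.mul_of_bound hζlip hζabs fun x hx => hC x (by_contra fun hxX => hx (hζX x hxX))
    have hβζsupp : HasCompactSupport (fun x => β x * ζ x) :=
      HasCompactSupport.intro hXb.isCompact_closure fun x hx => by
        rw [hζX x fun hxX => hx (subset_closure hxX), mul_zero]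
    have hparts := LipschitzWith.integral_lineDeriv_mul_eq (μ := μ) hw hβζ hβζsupp e
    have hprod : ∀ᵐ x ∂μ, lineDeriv ℝ (fun x => β x * ζ x) x (-e) * w x =
        -((lineDeriv ℝ β x e * ζ x + β x * lineDeriv ℝ ζ x e) * w x) := by
      filter_upwards [hβ.ae_lineDifferentiableAt e, hζlip.ae_lineDifferentiableAt e] with x h1 h2
      have h3 := HasDerivAt.mul (h1.hasLineDerivAt) (h2.hasLineDerivAt)
      simp only [zero_smul, add_zero] at h3
      have h4 : HasLineDerivAt ℝ (fun x => β x * ζ x)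
          (lineDeriv ℝ β x e * ζ x + β x * lineDeriv ℝ ζ x e) x e := h3
      rw [lineDeriv_neg, h4.lineDeriv, neg_mul]
    rw [integral_congr_ae hprod, integral_neg] at hparts
    have hA : ∫ x in X, lineDeriv ℝ w x e * (β x * ζ x) ∂μ =
        ∫ x, lineDeriv ℝ w x e * (β x * ζ x) ∂μ :=
      setIntegral_eq_integral_of_forall_compl_eq_zero fun x hx => by rw [hζX x hx]; ring
    have hB' : ∫ x in X, (lineDeriv ℝ β x e * ζ x + β x * lineDeriv ℝ ζ x e) * w x ∂μ =
        ∫ x, (lineDeriv ℝ β x e * ζ x + β x * lineDeriv ℝ ζ x e) * w x ∂μ :=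
      setIntegral_eq_integral_of_forall_compl_eq_zero fun x hx => by
        rw [hζX x hx, hζ'X x hx]; ring
    rw [← hA, ← hB'] at hparts
    have bound1 : ∀ x ∈ X, |lineDeriv ℝ w x e * (β x * ζ x)| ≤ B * Kw := by
      intro x hx
      rw [show lineDeriv ℝ w x e * (β x * ζ x) = β x * lineDeriv ℝ w x e * ζ x by ring, abs_mul]
      exact (mul_le_of_le_one_right (abs_nonneg _) (hζabs x)).trans (hβw' x hx)
    have bound2 : ∀ x ∈ X, |β x * lineDeriv ℝ ζ x e * w x| ≤ B * h * (δ * ε)⁻¹ := by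
      intro x hx
      rw [show β x * lineDeriv ℝ ζ x e * w x = β x * w x * lineDeriv ℝ ζ x e by ring, abs_mul,
        ← hKζ']
      exact mul_le_mul (hβw x hx) (hlip hζlip x) (abs_nonneg _) (by positivity)
    have bound3 : ∀ x ∈ X, |(lineDeriv ℝ β x e * ζ x + β x * lineDeriv ℝ ζ x e) * w x| ≤
        Kβ * h + B * h * (δ * ε)⁻¹ := by
      intro x hx
      rw [show (lineDeriv ℝ β x e * ζ x + β x * lineDeriv ℝ ζ x e) * w x =
        lineDeriv ℝ β x e * w x * ζ x + β x * lineDeriv ℝ ζ x e * w x by ring]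
      refine (abs_add_le _ _).trans (add_le_add ?_ (bound2 x hx))
      rw [abs_mul]
      exact (mul_le_of_le_one_right (abs_nonneg _) (hζabs x)).trans (hβ'w x hx)
    have boundI : ∀ x ∈ X, |β x * lineDeriv ℝ w x e + lineDeriv ℝ β x e * w x| ≤ D :=
      fun x hx => (abs_add_le _ _).trans (add_le_add (hβw' x hx) (hβ'w x hx))
    have int1 := hint _ (by fun_prop) bound1
    have int3 := hint _ (by fun_prop) bound3
    have intI := hint _ (by fun_prop) boundI
    have hIJ : ∫ x in X, (β x * lineDeriv ℝ w x e + lineDeriv ℝ β x e * w x) ∂μ =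
        ∫ x in X, ((β x * lineDeriv ℝ w x e + lineDeriv ℝ β x e * w x) * (1 - ζ x) -
          β x * lineDeriv ℝ ζ x e * w x) ∂μ := by
      have h1 : ∀ x, (β x * lineDeriv ℝ w x e + lineDeriv ℝ β x e * w x) * (1 - ζ x) -
          β x * lineDeriv ℝ ζ x e * w x =
          (β x * lineDeriv ℝ w x e + lineDeriv ℝ β x e * w x) -
          (lineDeriv ℝ w x e * (β x * ζ x) +
            (lineDeriv ℝ β x e * ζ x + β x * lineDeriv ℝ ζ x e) * w x) := fun x => by ring
      simp only [h1]
      have int13 : IntegrableOn (fun x => lineDeriv ℝ w x e * (β x * ζ x) +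
          (lineDeriv ℝ β x e * ζ x + β x * lineDeriv ℝ ζ x e) * w x) X μ := int1.add int3
      rw [integral_sub intI int13, integral_add int1 int3, hparts]
      ring
    have hJT : ∫ x in X, ((β x * lineDeriv ℝ w x e + lineDeriv ℝ β x e * w x) * (1 - ζ x) -
          β x * lineDeriv ℝ ζ x e * w x) ∂μ =
        ∫ x in T, ((β x * lineDeriv ℝ w x e + lineDeriv ℝ β x e * w x) * (1 - ζ x) -
          β x * lineDeriv ℝ ζ x e * w x) ∂μ := by
      refine setIntegral_eq_of_subset_of_forall_sdiff_eq_zero hXo.measurableSet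
        (Set.inter_subset_left.trans hSX) ?_
      rintro x ⟨hx, hxT⟩
      by_cases hxS : x ∈ S
      · have hxG : G x < 1 - 2 * ε := not_le.1 fun hG => hxT ⟨hxS, hG⟩
        have hev : ζ =ᶠ[nhds x] fun _ => 1 := by
          filter_upwards [(isOpen_lt hGc continuous_const).mem_nhds hxG] with y hy
          exact hζone y hy
        rw [hζone x hxG, hev.lineDeriv_eq]
        simp [lineDeriv]
      · rw [hoff x hx hxS, hoff' x hx hxS]; ring
    rw [hIJ, hJT]
    have hfinal := norm_setIntegral_le_of_norm_le_const (μ := μ) (s := T)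
      (C := D + B * h * (δ * ε)⁻¹)
      (f := fun x => (β x * lineDeriv ℝ w x e + lineDeriv ℝ β x e * w x) * (1 - ζ x) -
          β x * lineDeriv ℝ ζ x e * w x)
      (measure_lt_top_of_subset Set.inter_subset_left hSfin) (by
        intro x hx
        have hxX := hSX hx.1
        refine (abs_sub _ _).trans (add_le_add ?_ (bound2 x hxX))
        rw [abs_mul]
        refine (mul_le_of_le_one_right (abs_nonneg _) ?_).trans (boundI x hxX)
        rw [abs_le]
        exact ⟨by linarith [hζ1 x], by linarith [hζ0 x]⟩)
    rw [Real.norm_eq_abs] at hfinal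
    refine hfinal.trans ((mul_le_mul_of_nonneg_left hTvol (by positivity)).trans (le_of_eq ?_))
    field_simp
    ring
  have hlim : Filter.Tendsto (fun ε : ℝ => 2 * Module.finrank ℝ E * B * h / δ * μ.real S +
        ε * (2 * Module.finrank ℝ E * D * μ.real S)) (nhdsWithin 0 (Set.Ioi 0))
        (nhds (2 * Module.finrank ℝ E * B * h / δ * μ.real S)) := by
    have hc : Continuous fun ε : ℝ => 2 * Module.finrank ℝ E * B * h / δ * μ.real S +
        ε * (2 * Module.finrank ℝ E * D * μ.real S) := by fun_prop
    simpa using (hc.tendsto 0).mono_left nhdsWithin_le_nhds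
  refine ge_of_tendsto hlim ?_
  filter_upwards [Ioo_mem_nhdsGT (show (0 : ℝ) < 1 / 2 by norm_num)] with ε hε using main ε hε

end IntegrationByParts

section Gradient

variable {F : Type*} [NormedAddCommGroup F] [InnerProductSpace ℝ F] {f : F → ℝ}

theorem lipschitzWith_const_add_inner (c : ℝ) (P : F) :
    LipschitzWith ‖P‖₊ (fun x => c + ⟪P, x⟫) := by
  refine LipschitzWith.of_dist_le_mul fun x y => ?_
  rw [Real.dist_eq, add_sub_add_left_eq_sub, ← inner_sub_right, dist_eq_norm]
  exact abs_real_inner_le_norm _ _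

variable [CompleteSpace F]

theorem LipschitzWith.norm_gradient_le {K : NNReal} (hf : LipschitzWith K f) (x : F) :
    ‖gradient f x‖ ≤ K := by
  rw [gradient, LinearIsometryEquiv.norm_map]
  exact norm_fderiv_le_of_lipschitz ℝ hf

theorem lineDeriv_eq_inner_gradient {x : F} (hf : DifferentiableAt ℝ f x) (e : F) :
    lineDeriv ℝ f x e = ⟪gradient f x, e⟫ := by
  rw [hf.lineDeriv_eq_fderiv, gradient, InnerProductSpace.toDual_symm_apply]

theorem gradient_eq_zero_of_forall_le {x : F} (h : ∀ y, f x ≤ f y) : gradient f x = 0 := by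
  have : IsLocalMin f x := Filter.Eventually.of_forall h
  rw [gradient, this.fderiv_eq_zero, map_zero]

theorem gradient_const_add_inner (c : ℝ) (P x : F) : gradient (fun x => c + ⟪P, x⟫) x = P := by
  refine HasGradientAt.gradient ?_
  rw [hasGradientAt_iff_hasFDerivAt]
  exact ((innerSL ℝ P).hasFDerivAt (x := x)).const_add c

variable [MeasurableSpace F] [BorelSpace F]

theorem measurable_gradient : Measurable (gradient f) :=
  (InnerProductSpace.toDual ℝ F).symm.continuous.measurable.comp (measurable_fderiv ℝ f)

theorem LipschitzWith.integrableOn_comp_gradient [FiniteDimensional ℝ F] {μ : Measure F}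
    [IsFiniteMeasureOnCompacts μ] {K : NNReal} (hf : LipschitzWith K f) {X : Set F}
    (hX : MeasurableSet X) (hXb : Bornology.IsBounded X) {Φ : F → F → ℝ}
    (hΦ : Continuous (Function.uncurry Φ)) : IntegrableOn (fun x => Φ x (gradient f x)) X μ := by
  obtain ⟨C, hC⟩ := (hXb.isCompact_closure.prod
    (isCompact_closedBall (0 : F) K)).exists_bound_of_continuousOn hΦ.continuousOn
  refine Measure.integrableOn_of_bounded (M := C) hXb.measure_lt_top.ne ?_ ?_
  · exact (hΦ.measurable.comp (measurable_id.prodMk measurable_gradient)).aestronglyMeasurable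
  · refine (ae_restrict_iff' hX).2 (Filter.Eventually.of_forall fun x hx => ?_)
    exact hC (x, gradient f x)
      ⟨subset_closure hx, mem_closedBall_zero_iff.2 (hf.norm_gradient_le x)⟩

end Gradient

section Estimates

variable {n : ℕ} {X : Set (EuclideanSpace ℝ (Fin n))}

/-- The energy inequality obtained by comparing `u` with its maximum with an affine function. -/
theorem setIntegral_norm_gradient_sq_le (hXo : IsOpen X) (hXb : Bornology.IsBounded X)
    {q : ℝ} (hq1 : 1 < q) (hq2 : q ≤ 2) {γ : EuclideanSpace ℝ (Fin n) → ℝ} (hγ : Continuous γ)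
    {lam : ℝ} (hlam : 0 < lam) (hγlb : ∀ x ∈ X, lam ≤ γ x) {u : EuclideanSpace ℝ (Fin n) → ℝ}
    {M : NNReal} (hM : 0 < M) (hu : LipschitzWith M u) {P : EuclideanSpace ℝ (Fin n)}
    (hP : ‖P‖ ≤ M) (c : ℝ)
    (hmin : rochetChone X γ q u ≤ rochetChone X γ q (fun x => max (u x) (c + ⟪P, x⟫)))
    {w : EuclideanSpace ℝ (Fin n) → ℝ} (hw : w = fun x => max 0 (c + ⟪P, x⟫ - u x)) :
    (q - 1) / 2 * (M : ℝ) ^ (q - 2) * lam * ∫ x in X, ‖gradient w x‖ ^ 2 ≤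
      (∫ x in X, γ x * ⟪‖P‖ ^ (q - 2) • P - x, gradient w x⟫) + ∫ x in X, γ x * w x := by
  set κ := (q - 1) / 2 * (M : ℝ) ^ (q - 2) with hκ
  have hκ0 : 0 ≤ κ := mul_nonneg (by linarith) (Real.rpow_nonneg M.2 _)
  set v : EuclideanSpace ℝ (Fin n) → ℝ := fun x => max (u x) (c + ⟪P, x⟫) with hv
  have hℓ := lipschitzWith_const_add_inner c P
  have hvuw : v = fun x => u x + w x := by
    ext x
    simp only [hv, hw]
    rw [← max_add_add_left]
    simp
  have hwlip : LipschitzWith (‖P‖₊ + M) w := by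
    rw [hw]
    exact (hℓ.sub hu).const_max 0
  have hvlip : LipschitzWith (M + (‖P‖₊ + M)) v := by
    rw [hvuw]
    exact hu.add hwlip
  have huc := hu.continuous
  have hvc := hvlip.continuous
  have hwc := hwlip.continuous
  have hpow : Continuous fun g : EuclideanSpace ℝ (Fin n) => ‖g‖ ^ q :=
    continuous_norm.rpow_const fun _ => Or.inr (by linarith)
  have hpow' : Continuous fun z : EuclideanSpace ℝ (Fin n) × EuclideanSpace ℝ (Fin n) =>
    ‖z.2‖ ^ q := hpow.comp continuous_snd
  have hXm := hXo.measurableSet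
  have intu : IntegrableOn (fun x => (‖gradient u x‖ ^ q / q - ⟪x, gradient u x⟫ + u x) * γ x) X :=
    hu.integrableOn_comp_gradient hXm hXb (Φ := fun x g => (‖g‖ ^ q / q - ⟪x, g⟫ + u x) * γ x)
      (by unfold Function.uncurry; fun_prop)
  have intv : IntegrableOn (fun x => (‖gradient v x‖ ^ q / q - ⟪x, gradient v x⟫ + v x) * γ x) X :=
    hvlip.integrableOn_comp_gradient hXm hXb (Φ := fun x g => (‖g‖ ^ q / q - ⟪x, g⟫ + v x) * γ x)
      (by unfold Function.uncurry; fun_prop)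
  have int1 : IntegrableOn (fun x => γ x * ⟪‖P‖ ^ (q - 2) • P - x, gradient w x⟫) X :=
    hwlip.integrableOn_comp_gradient hXm hXb
      (Φ := fun x g => γ x * ⟪‖P‖ ^ (q - 2) • P - x, g⟫) (by unfold Function.uncurry; fun_prop)
  have int2 : IntegrableOn (fun x => γ x * w x) X :=
    hwlip.integrableOn_comp_gradient hXm hXb
      (Φ := fun x _ => γ x * w x) (by unfold Function.uncurry; fun_prop)
  have int3 : IntegrableOn (fun x => κ * lam * ‖gradient w x‖ ^ 2) X :=
    hwlip.integrableOn_comp_gradient hXm hXb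
      (Φ := fun _ g => κ * lam * ‖g‖ ^ 2) (by unfold Function.uncurry; fun_prop)
  have hpt : ∀ᵐ x ∂(volume.restrict X),
      κ * lam * ‖gradient w x‖ ^ 2 +
        (‖gradient v x‖ ^ q / q - ⟪x, gradient v x⟫ + v x) * γ x ≤
      (γ x * ⟪‖P‖ ^ (q - 2) • P - x, gradient w x⟫ + γ x * w x) +
        (‖gradient u x‖ ^ q / q - ⟪x, gradient u x⟫ + u x) * γ x := by
    rw [ae_restrict_iff' hXm]
    filter_upwards [hu.ae_differentiableAt, hwlip.ae_differentiableAt] with x hux hwx hx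
    have hgv : gradient v x = gradient u x + gradient w x := by
      rw [hvuw, gradient, fderiv_fun_add hux hwx, map_add, gradient, gradient]
    have hvx : v x = u x + w x := congrFun hvuw x
    have hγx := hγlb x hx
    have hcost : ‖gradient v x‖ ^ q / q + κ * ‖gradient w x‖ ^ 2 ≤
        ‖gradient u x‖ ^ q / q + ⟪‖P‖ ^ (q - 2) • P, gradient w x⟫ := by
      by_cases hpos : u x < c + ⟪P, x⟫
      · have hev : v =ᶠ[nhds x] fun x => c + ⟪P, x⟫ := by
          filter_upwards [(isOpen_lt huc hℓ.continuous).mem_nhds hpos] with y hy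
          exact max_eq_right (le_of_lt hy)
        have hgP : gradient v x = P := by
          rw [gradient, hev.fderiv_eq, ← gradient, gradient_const_add_inner]
        have h := norm_rpow_div_strong_convex hq1 hq2 (NNReal.coe_pos.2 hM)
          (hu.norm_gradient_le x) hP
        have hsub : gradient u x - P = -gradient w x := by rw [← hgP, hgv]; abel
        rw [hsub, inner_neg_right, norm_neg, ← hκ] at h
        rw [hgP]
        linarith
      · have hw0 : w x = 0 := by
          rw [hw]
          exact max_eq_left (by linarith)
        have hgw : gradient w x = 0 := gradient_eq_zero_of_forall_le fun y => by
          rw [hw0, hw]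
          exact le_max_left _ _
        rw [hgv, hgw]
        simp
    rw [hvx, inner_sub_left]
    have hxv : ⟪x, gradient v x⟫ = ⟪x, gradient u x⟫ + ⟪x, gradient w x⟫ := by
      rw [hgv, inner_add_right]
    rw [hxv]
    have h1 : κ * lam * ‖gradient w x‖ ^ 2 ≤ κ * γ x * ‖gradient w x‖ ^ 2 := by gcongr
    have h2 := mul_le_mul_of_nonneg_left hcost (hlam.le.trans hγx)
    linarith
  have int12 : IntegrableOn
      (fun x => γ x * ⟪‖P‖ ^ (q - 2) • P - x, gradient w x⟫ + γ x * w x) X := int1.add int2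
  have hle := integral_mono_ae (int3.add intv) (int12.add intu) hpt
  simp only [Pi.add_apply] at hle
  rw [integral_add int3 intv, integral_add int12 intu, integral_add int1 int2,
    integral_const_mul] at hle
  unfold rochetChone at hmin
  linarith

/-- The first variation of the functional is controlled by the volume of the positivity set. -/
theorem setIntegral_inner_gradient_le (hXo : IsOpen X) (hXc : Convex ℝ X)
    (hXb : Bornology.IsBounded X) {x₀ : EuclideanSpace ℝ (Fin n)} {δ : NNReal} (hδ : 0 < δ)
    (hball : Metric.ball x₀ δ ⊆ X) {γ : EuclideanSpace ℝ (Fin n) → ℝ} {Kγ G : NNReal}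
    (hγ : LipschitzOnWith Kγ γ X) (hγG : ∀ x ∈ X, |γ x| ≤ G) {b : EuclideanSpace ℝ (Fin n)}
    {D : NNReal} (hbD : ∀ x ∈ X, ‖b - x‖ ≤ D) {w : EuclideanSpace ℝ (Fin n) → ℝ} {Kw : NNReal}
    (hw : LipschitzWith Kw w) (hw0 : ∀ x, 0 ≤ w x) {S : Set (EuclideanSpace ℝ (Fin n))}
    (hS : S = {x ∈ X | 0 < w x}) (hSc : Convex ℝ S) (hx₀ : x₀ ∈ S) {h : ℝ}
    (hwh : ∀ x ∈ X, w x ≤ h) :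
    ∫ x in X, γ x * ⟪b - x, gradient w x⟫ ≤
      n * ((G + D * Kγ) + 2 * n * (G * D) / δ) * h * volume.real S := by
  have hSX : S ⊆ X := by rw [hS]; exact fun x hx => hx.1
  have hSfin : volume S ≠ ⊤ := measure_ne_top_of_subset hSX hXb.measure_lt_top.ne
  have hh0 : 0 ≤ h := (hw0 x₀).trans (hwh x₀ (hSX hx₀))
  have hcoord : ∀ x ∈ X, ∀ i, |b i - x i| ≤ D := fun x hx i =>
    (PiLp.norm_apply_le (b - x) i).trans (hbD x hx)
  have hβ : ∀ i, ∃ β : EuclideanSpace ℝ (Fin n) → ℝ, LipschitzWith (G + D * Kγ) β ∧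
      Set.EqOn (fun x => γ x * (b i - x i)) β X := by
    intro i
    refine LipschitzOnWith.extend_real (LipschitzOnWith.of_dist_le_mul fun x hx y hy => ?_)
    have h1 := hγ.dist_le_mul x hx y hy
    have h2 : |y i - x i| ≤ dist x y := by
      rw [dist_comm, dist_eq_norm]
      exact PiLp.norm_apply_le (y - x) i
    rw [Real.dist_eq] at h1 ⊢
    calc |γ x * (b i - x i) - γ y * (b i - y i)|
        = |γ x * (y i - x i) + (b i - y i) * (γ x - γ y)| := by ring_nf
      _ ≤ |γ x| * |y i - x i| + |b i - y i| * |γ x - γ y| := by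
        rw [← abs_mul, ← abs_mul]; exact abs_add_le _ _
      _ ≤ G * dist x y + D * (Kγ * dist x y) := by
        gcongr
        exacts [hγG x hx, hcoord y hy i]
      _ = _ := by push_cast; ring
  choose β hβlip hβeq using hβ
  have hnorm : ∀ i : Fin n, ‖EuclideanSpace.single i (1 : ℝ)‖ ≤ 1 := fun i => by simp
  have hint : ∀ {f : EuclideanSpace ℝ (Fin n) → ℝ} (C : ℝ), Measurable f →
      (∀ x ∈ X, |f x| ≤ C) → IntegrableOn f X := by
    intro f C hf hC
    exact Measure.integrableOn_of_bounded (M := C) hXb.measure_lt_top.ne hf.aestronglyMeasurable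
      ((ae_restrict_iff' hXo.measurableSet).2 (Filter.Eventually.of_forall hC))
  have hβB : ∀ i, ∀ x ∈ X, |β i x| ≤ G * D := by
    intro i x hx
    rw [← hβeq i hx, abs_mul]
    exact mul_le_mul (hγG x hx) (hcoord x hx i) (abs_nonneg _) G.2
  have hlip : ∀ {f : EuclideanSpace ℝ (Fin n) → ℝ} {K : NNReal}, LipschitzWith K f → ∀ x i,
      |lineDeriv ℝ f x (EuclideanSpace.single i 1)| ≤ K := by
    intro f K hf x i
    have := norm_lineDeriv_le_of_lipschitz ℝ hf (x₀ := x) (v := EuclideanSpace.single i 1)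
    rw [Real.norm_eq_abs] at this
    exact this.trans (mul_le_of_le_one_right K.2 (hnorm i))
  have hint1 : ∀ i, IntegrableOn
      (fun x => β i x * lineDeriv ℝ w x (EuclideanSpace.single i 1)) X := by
    intro i
    have hm := measurable_lineDeriv (𝕜 := ℝ) (v := EuclideanSpace.single i 1) hw.continuous
    have hm' := (hβlip i).continuous.measurable
    refine hint (G * D * Kw) (by fun_prop) fun x hx => ?_
    rw [abs_mul]
    exact mul_le_mul (hβB i x hx) (hlip hw x i) (abs_nonneg _) (by positivity)
  have hbound2 : ∀ i, ∀ x ∈ X, |lineDeriv ℝ (β i) x (EuclideanSpace.single i 1) * w x| ≤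
      (G + D * Kγ) * h := by
    intro i x hx
    rw [abs_mul, abs_of_nonneg (hw0 x)]
    have := hlip (hβlip i) x i
    push_cast at this
    exact mul_le_mul this (hwh x hx) (hw0 x) (by positivity)
  have hint2 : ∀ i, IntegrableOn
      (fun x => lineDeriv ℝ (β i) x (EuclideanSpace.single i 1) * w x) X := by
    intro i
    have hm := measurable_lineDeriv (𝕜 := ℝ) (v := EuclideanSpace.single i 1)
      (hβlip i).continuous
    have hm' := hw.continuous.measurable
    exact hint _ (by fun_prop) (hbound2 i)
  have hsum : ∫ x in X, γ x * ⟪b - x, gradient w x⟫ =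
      ∑ i, ∫ x in X, β i x * lineDeriv ℝ w x (EuclideanSpace.single i 1) := by
    rw [← integral_finsetSum _ fun i _ => hint1 i]
    refine integral_congr_ae ?_
    rw [Filter.EventuallyEq, ae_restrict_iff' hXo.measurableSet]
    filter_upwards [hw.ae_differentiableAt] with x hwx hx
    rw [PiLp.inner_apply, Finset.mul_sum]
    refine Finset.sum_congr rfl fun i _ => ?_
    rw [← hβeq i hx, lineDeriv_eq_inner_gradient hwx, EuclideanSpace.inner_single_right]
    simp
    ring
  have hterm : ∀ i, ∫ x in X, β i x * lineDeriv ℝ w x (EuclideanSpace.single i 1) ≤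
      ((G + D * Kγ) + 2 * n * (G * D) / δ) * h * volume.real S := by
    intro i
    have h1 := abs_setIntegral_lineDeriv_mul_le volume hXo hXc hXb hδ hball hw (hβlip i) hw0 hS
      hSc hx₀ hwh (fun x hx => hβB i x (hSX hx)) (hnorm i)
    rw [integral_add (hint1 i) (hint2 i), finrank_euclideanSpace_fin] at h1
    have h2 : |∫ x in X, lineDeriv ℝ (β i) x (EuclideanSpace.single i 1) * w x| ≤
        (G + D * Kγ) * h * volume.real S := by
      rw [setIntegral_eq_of_subset_of_forall_sdiff_eq_zero hXo.measurableSet hSX]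
      · exact norm_setIntegral_le_of_norm_le_const
          (f := fun x => lineDeriv ℝ (β i) x (EuclideanSpace.single i 1) * w x) hSfin.lt_top
          fun x hx => hbound2 i x (hSX hx)
      · rintro x ⟨hx, hxS⟩
        rw [hS] at hxS
        rw [le_antisymm (not_lt.1 fun h => hxS ⟨hx, h⟩) (hw0 x), mul_zero]
    have h3 := (abs_le.1 h1).2
    have h4 := (abs_le.1 h2).1
    have h5 : ((G + D * Kγ) + 2 * n * (G * D) / δ) * h * volume.real S =
      (G + D * Kγ) * h * volume.real S + 2 * n * (G * D) * h / δ * volume.real S := by ring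
    linarith
  rw [hsum]
  refine (Finset.sum_le_sum fun i _ => hterm i).trans (le_of_eq ?_)
  simp
  ring

end Estimates

section Regularity

variable {n : ℕ} {X : Set (EuclideanSpace ℝ (Fin n))}

/-- A concave function on a convex set is at least half its value at `x₀` on the dilation of ratio
one half of the set about `x₀`. -/
theorem mul_volume_le_setIntegral_of_concaveOn (hXb : Bornology.IsBounded X)
    {w : EuclideanSpace ℝ (Fin n) → ℝ} (hw : Continuous w) (hw0 : ∀ x, 0 ≤ w x)
    {S : Set (EuclideanSpace ℝ (Fin n))} (hSX : S ⊆ X) (hwc : ConcaveOn ℝ S w)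
    (hSo : IsOpen S) {x₀ : EuclideanSpace ℝ (Fin n)} (hx₀ : x₀ ∈ S) :
    w x₀ / 2 ^ (n + 1) * volume.real S ≤ ∫ x in X, w x := by
  have hXfin : volume X ≠ ⊤ := hXb.measure_lt_top.ne
  set T := AffineMap.homothety x₀ (1 / 2 : ℝ) '' S with hT
  have hTo : IsOpen T := AffineMap.homothety_isOpenMap x₀ _ (by norm_num) S hSo
  have hTS : T ⊆ S := by
    rintro _ ⟨x, hx, rfl⟩
    rw [AffineMap.homothety_eq_lineMap]
    exact hwc.1.lineMap_mem hx₀ hx ⟨by norm_num, by norm_num⟩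
  have hTvol : volume.real T = volume.real S / 2 ^ n := by
    rw [hT, Measure.real, Measure.addHaar_image_homothety, ENNReal.toReal_mul,
      ENNReal.toReal_ofReal (abs_nonneg _), finrank_euclideanSpace_fin,
      abs_of_nonneg (by positivity), ← Measure.real, one_div, inv_pow]
    ring
  have hTw : ∀ x ∈ T, w x₀ / 2 ≤ w x := by
    rintro _ ⟨x, hx, rfl⟩
    have h := hwc.2 hx₀ hx (by norm_num : (0 : ℝ) ≤ 1 / 2) (by norm_num : (0 : ℝ) ≤ 1 / 2)
      (by norm_num)
    have hz : AffineMap.homothety x₀ (1 / 2 : ℝ) x = (1 / 2 : ℝ) • x₀ + (1 / 2 : ℝ) • x := by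
      rw [AffineMap.homothety_apply, vsub_eq_sub, vadd_eq_add]
      module
    rw [hz]
    simp only [smul_eq_mul] at h
    linarith [hw0 x]
  have hwi : IntegrableOn w X := by
    refine (hw.continuousOn.integrableOn_compact hXb.isCompact_closure).mono_set subset_closure
  calc w x₀ / 2 ^ (n + 1) * volume.real S = ∫ x in T, w x₀ / 2 := by
        rw [setIntegral_const, hTvol, smul_eq_mul]
        ring
    _ ≤ ∫ x in T, w x := by
        refine setIntegral_mono_on ?_ (hwi.mono_set (hTS.trans hSX)) hTo.measurableSet hTw
        exact integrableOn_const (measure_ne_top_of_subset (hTS.trans hSX) hXfin)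
    _ ≤ ∫ x in X, w x :=
        setIntegral_mono_set hwi (Filter.Eventually.of_forall hw0)
          (Filter.Eventually.of_forall (hTS.trans hSX))

/-- A Poincaré-type inequality on a thin convex positivity set. -/
theorem mul_volume_le_mul_setIntegral_norm_gradient (hXo : IsOpen X) (hXc : Convex ℝ X)
    (hXb : Bornology.IsBounded X) {x₀ : EuclideanSpace ℝ (Fin n)} {δ : NNReal} (hδ : 0 < δ)
    (hball : Metric.ball x₀ δ ⊆ X) {w : EuclideanSpace ℝ (Fin n) → ℝ} {Kw : NNReal}
    (hw : LipschitzWith Kw w) (hw0 : ∀ x, 0 ≤ w x) {S : Set (EuclideanSpace ℝ (Fin n))}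
    (hS : S = {x ∈ X | 0 < w x}) (hwc : ConcaveOn ℝ S w) (hx₀ : x₀ ∈ S) {h : ℝ}
    (hwh : ∀ x ∈ X, w x ≤ h) (hwx₀ : h / 2 ≤ w x₀) {ξ : EuclideanSpace ℝ (Fin n)} (hξ : ‖ξ‖ = 1)
    {r : ℝ} (hSr : ∀ x ∈ S, |⟪ξ, x - x₀⟫| ≤ r) (hr : 2 ^ (n + 4) * n * r ≤ δ) :
    h / 2 ^ (n + 3) * volume.real S ≤ r * ∫ x in X, ‖gradient w x‖ := by
  have hSX : S ⊆ X := by rw [hS]; exact fun x hx => hx.1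
  have hSo : IsOpen S := by
    rw [hS]
    exact hXo.inter (isOpen_lt continuous_const hw.continuous)
  have hh0 : 0 ≤ h := (hw0 x₀).trans (hwh x₀ (hSX hx₀))
  have hmass := mul_volume_le_setIntegral_of_concaveOn hXb hw.continuous hw0 hSX hwc hSo hx₀
  set β : EuclideanSpace ℝ (Fin n) → ℝ := fun x => -⟪ξ, x₀⟫ + ⟪ξ, x⟫ with hβ
  have hβlip : LipschitzWith ‖ξ‖₊ β := lipschitzWith_const_add_inner (-⟪ξ, x₀⟫) ξ
  have hβx : ∀ x, β x = ⟪ξ, x - x₀⟫ := fun x => by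
    rw [inner_sub_right, hβ]
    ring
  have hβd : ∀ x, lineDeriv ℝ β x ξ = 1 := fun x => by
    have hd : DifferentiableAt ℝ β x :=
      ((innerSL ℝ ξ).differentiableAt (x := x)).const_add (-⟪ξ, x₀⟫)
    rw [lineDeriv_eq_inner_gradient hd, gradient_const_add_inner, real_inner_self_eq_norm_sq, hξ,
      one_pow]
  have hflux := abs_setIntegral_lineDeriv_mul_le volume hXo hXc hXb hδ hball hw hβlip hw0 hS
    hwc.1 hx₀ hwh (B := r) (fun x hx => by rw [hβx]; exact hSr x hx) hξ.le
  simp only [hβd, one_mul] at hflux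
  have hwi : IntegrableOn w X :=
    (hw.continuous.continuousOn.integrableOn_compact hXb.isCompact_closure).mono_set subset_closure
  have hgi : IntegrableOn (fun x => ‖gradient w x‖) X :=
    hw.integrableOn_comp_gradient hXo.measurableSet hXb (Φ := fun _ g => ‖g‖)
      (by unfold Function.uncurry; fun_prop)
  have hβc : Continuous β := hβlip.continuous
  have hβi : IntegrableOn (fun x => β x * ⟪gradient w x, ξ⟫) X :=
    hw.integrableOn_comp_gradient hXo.measurableSet hXb (Φ := fun x g => β x * ⟪g, ξ⟫)
      (by unfold Function.uncurry; fun_prop)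
  have heq : ∫ x in X, (β x * lineDeriv ℝ w x ξ + w x) =
      ∫ x in X, (β x * ⟪gradient w x, ξ⟫ + w x) := by
    refine integral_congr_ae (ae_restrict_of_ae ?_)
    filter_upwards [hw.ae_differentiableAt] with x hx
    rw [lineDeriv_eq_inner_gradient hx]
  rw [heq, integral_add hβi hwi, finrank_euclideanSpace_fin] at hflux
  have hlow : -(r * ∫ x in X, ‖gradient w x‖) ≤ ∫ x in X, β x * ⟪gradient w x, ξ⟫ := by
    rw [← integral_const_mul, ← integral_neg]
    refine setIntegral_mono_on (hgi.const_mul r).neg hβi hXo.measurableSet fun x hx => ?_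
    by_cases hxS : x ∈ S
    · have h1 : |β x * ⟪gradient w x, ξ⟫| ≤ r * ‖gradient w x‖ := by
        rw [abs_mul, hβx]
        refine mul_le_mul (hSr x hxS) ?_ (abs_nonneg _) ((abs_nonneg _).trans (hSr x hxS))
        simpa [hξ] using abs_real_inner_le_norm (gradient w x) ξ
      exact (abs_le.1 h1).1
    · have hwx : w x = 0 :=
        le_antisymm (not_lt.1 fun h => hxS (by rw [hS]; exact ⟨hx, h⟩)) (hw0 x)
      rw [gradient_eq_zero_of_forall_le fun y => hwx.trans_le (hw0 y)]
      simp
  have hsmall : 2 * n * r * h / δ * volume.real S ≤ h / 2 ^ (n + 3) * volume.real S := by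
    refine mul_le_mul_of_nonneg_right ?_ measureReal_nonneg
    rw [div_le_div_iff₀ (NNReal.coe_pos.2 hδ) (by positivity)]
    have := mul_le_mul_of_nonneg_left hr hh0
    calc 2 * n * r * h * 2 ^ (n + 3) = h * (2 ^ (n + 4) * n * r) := by ring
      _ ≤ h * δ := this
  have hmass' : h / 2 ^ (n + 2) * volume.real S ≤ ∫ x in X, w x := by
    refine le_trans (mul_le_mul_of_nonneg_right ?_ measureReal_nonneg) hmass
    calc h / 2 ^ (n + 2) = h / 2 / 2 ^ (n + 1) := by rw [div_div]; ring
      _ ≤ _ := by gcongr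
  have hsplit : h / 2 ^ (n + 2) * volume.real S =
      h / 2 ^ (n + 3) * volume.real S + h / 2 ^ (n + 3) * volume.real S := by
    rw [pow_succ 2 (n + 2)]
    ring
  have := (abs_le.1 hflux).2
  linarith

theorem setIntegral_norm_gradient_le_add (hXo : IsOpen X) (hXb : Bornology.IsBounded X)
    {w : EuclideanSpace ℝ (Fin n) → ℝ} {Kw : NNReal} (hw : LipschitzWith Kw w)
    (hw0 : ∀ x, 0 ≤ w x) {S : Set (EuclideanSpace ℝ (Fin n))} (hS : S = {x ∈ X | 0 < w x})
    {a : ℝ} (ha : 0 < a) :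
    ∫ x in X, ‖gradient w x‖ ≤
      a / 2 * (∫ x in X, ‖gradient w x‖ ^ 2) + volume.real S / (2 * a) := by
  have hSX : S ⊆ X := by rw [hS]; exact fun x hx => hx.1
  have hSfin : volume S ≠ ⊤ := measure_ne_top_of_subset hSX hXb.measure_lt_top.ne
  have hg1 : IntegrableOn (fun x => ‖gradient w x‖) X :=
    hw.integrableOn_comp_gradient hXo.measurableSet hXb (Φ := fun _ g => ‖g‖)
      (by unfold Function.uncurry; fun_prop)
  have hg2 : IntegrableOn (fun x => ‖gradient w x‖ ^ 2) X :=
    hw.integrableOn_comp_gradient hXo.measurableSet hXb (Φ := fun _ g => ‖g‖ ^ 2)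
      (by unfold Function.uncurry; fun_prop)
  have hz : ∀ x ∈ X \ S, gradient w x = 0 := by
    rintro x ⟨hx, hxS⟩
    have hwx : w x = 0 :=
      le_antisymm (not_lt.1 fun h => hxS (by rw [hS]; exact ⟨hx, h⟩)) (hw0 x)
    exact gradient_eq_zero_of_forall_le fun y => hwx.trans_le (hw0 y)
  rw [setIntegral_eq_of_subset_of_forall_sdiff_eq_zero hXo.measurableSet hSX
      (f := fun x => ‖gradient w x‖) fun x hx => by simp [hz x hx],
    setIntegral_eq_of_subset_of_forall_sdiff_eq_zero hXo.measurableSet hSX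
      (f := fun x => ‖gradient w x‖ ^ 2) fun x hx => by simp [hz x hx]]
  have hc : IntegrableOn (fun _ => 1 / (2 * a)) S := integrableOn_const hSfin
  calc ∫ x in S, ‖gradient w x‖ ≤ ∫ x in S, (a / 2 * ‖gradient w x‖ ^ 2 + 1 / (2 * a)) := by
        refine integral_mono (hg1.mono_set hSX)
          (((hg2.mono_set hSX).const_mul (a / 2)).add hc) fun x => ?_
        have h : a / 2 * ‖gradient w x‖ ^ 2 + 1 / (2 * a) - ‖gradient w x‖ =
            (a * ‖gradient w x‖ - 1) ^ 2 / (2 * a) := by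
          field_simp
          ring
        have : 0 ≤ (a * ‖gradient w x‖ - 1) ^ 2 / (2 * a) := by positivity
        simp only
        linarith
    _ = _ := by
        rw [integral_add ((hg2.mono_set hSX).const_mul (a / 2)) hc, integral_const_mul,
          setIntegral_const, smul_eq_mul]
        ring

/-- Two supporting hyperplanes of `u`, at `x₀` and `x₁`, yield an affine function lying above `u`
at `x₀` and exceeding `u` only in a slab of width comparable to the distance of `x₀` and `x₁`. -/
theorem exists_affine_cap {u : EuclideanSpace ℝ (Fin n) → ℝ}
    {x₀ x₁ p p₁ : EuclideanSpace ℝ (Fin n)}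
    (hx₀ : x₀ ∈ X) (hp : p ∈ subgrad X u x₀) (hp₁ : p₁ ∈ subgrad X u x₁) {h : ℝ}
    (hh : h = u x₁ - u x₀ - ⟪p, x₁ - x₀⟫) (hpos : 0 < h) :
    ∃ ξ P : EuclideanSpace ℝ (Fin n), ∃ c : ℝ, ‖ξ‖ = 1 ∧ P ∈ segment ℝ p p₁ ∧
      c + ⟪P, x₀⟫ - u x₀ = h / 2 ∧ ∀ x ∈ X, u x < c + ⟪P, x⟫ →
        |⟪ξ, x - x₀⟫| ≤ ‖x₁ - x₀‖ ∧ c + ⟪P, x⟫ - u x ≤ h := by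
  set r := ‖x₁ - x₀‖ with hr
  set a := ‖p₁ - p‖ with ha
  have hle : h ≤ ⟪p₁ - p, x₁ - x₀⟫ := by
    have := hp₁ x₀ hx₀
    rw [← neg_sub x₁ x₀, inner_neg_right] at this
    rw [inner_sub_left]
    linarith
  have har : h ≤ a * r := hle.trans (real_inner_le_norm _ _)
  have hr0 : 0 < r := by
    by_contra hcon
    have : r = 0 := le_antisymm (not_lt.1 hcon) (norm_nonneg _)
    rw [this, mul_zero] at har
    linarith
  have ha0 : 0 < a := by
    by_contra hcon
    have : a = 0 := le_antisymm (not_lt.1 hcon) (norm_nonneg _)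
    rw [this, zero_mul] at har
    linarith
  set ξ := a⁻¹ • (p₁ - p) with hξ
  have hξ1 : ‖ξ‖ = 1 := by
    rw [hξ, norm_smul, norm_inv, Real.norm_of_nonneg ha0.le, ← ha, inv_mul_cancel₀ ha0.ne']
  have hpξ : p₁ - p = a • ξ := by rw [hξ, smul_inv_smul₀ ha0.ne']
  set t := h / (2 * r) with ht
  have ht0 : 0 < t := by positivity
  have htr : t * r = h / 2 := by rw [ht]; field_simp
  have hta : t < a := by
    rw [ht, div_lt_iff₀ (by positivity)]
    nlinarith
  clear_value ξ
  refine ⟨ξ, p + t • ξ, u x₀ - ⟪p, x₀⟫ - t * ⟪ξ, x₀⟫ + t * r, hξ1, ?_, ?_, ?_⟩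
  · refine ⟨1 - t / a, t / a, ?_, by positivity, by ring, ?_⟩
    · rw [sub_nonneg, div_le_one ha0]
      exact hta.le
    · have : p₁ = p + a • ξ := by rw [← hpξ]; abel
      rw [this, smul_add, smul_smul, div_mul_cancel₀ _ ha0.ne']
      module
  · rw [inner_add_left, real_inner_smul_left]
    linarith
  · intro x hx hlt
    have hτ₁ : ⟪ξ, x₁ - x₀⟫ ≤ r := by
      simpa [hξ1] using real_inner_le_norm ξ (x₁ - x₀)
    have h0 := hp x hx
    have h1 := hp₁ x hx
    have hℓ : u x₀ - ⟪p, x₀⟫ - t * ⟪ξ, x₀⟫ + t * r + ⟪p + t • ξ, x⟫ =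
        u x₀ + ⟪p, x - x₀⟫ + t * (⟪ξ, x - x₀⟫ + r) := by
      simp only [inner_add_left, inner_sub_right, real_inner_smul_left]
      ring
    rw [hℓ] at hlt ⊢
    have hp₁x : ⟪p₁, x - x₁⟫ = ⟪p, x - x₀⟫ - ⟪p, x₁ - x₀⟫ +
        a * (⟪ξ, x - x₀⟫ - ⟪ξ, x₁ - x₀⟫) := by
      have : p₁ = p + a • ξ := by rw [← hpξ]; abel
      rw [this]
      simp only [inner_add_left, inner_sub_right, real_inner_smul_left]
      ring
    rw [hp₁x] at h1
    set τ := ⟪ξ, x - x₀⟫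
    set τ₁ := ⟪ξ, x₁ - x₀⟫
    have hlow : -r < τ := by
      by_contra hcon
      nlinarith
    have hupp : τ < r := by
      by_contra hcon
      nlinarith
    exact ⟨abs_le.2 ⟨hlow.le, hupp.le⟩, by nlinarith⟩

theorem norm_rpow_smul_le {P : EuclideanSpace ℝ (Fin n)} {q : ℝ} (hq : 1 < q) {M : NNReal}
    (hP : ‖P‖ ≤ M) : ‖‖P‖ ^ (q - 2) • P‖ ≤ (M : ℝ) ^ (q - 1) := by
  rcases eq_or_ne P 0 with rfl | hP0
  · simpa using Real.rpow_nonneg M.2 _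
  · rw [norm_smul, Real.norm_of_nonneg (Real.rpow_nonneg (norm_nonneg _) _),
      ← Real.rpow_add_one (norm_ne_zero_iff.2 hP0)]
    refine (Real.rpow_le_rpow (norm_nonneg _) hP (by linarith)).trans (le_of_eq ?_)
    ring_nf

/-- Interior quadratic detachment: a minimizer separates at most quadratically from its supporting
hyperplanes. -/
theorem exists_forall_sub_le_mul_sq (hXo : IsOpen X) (hXc : Convex ℝ X)
    (hXb : Bornology.IsBounded X) {Y : Set (EuclideanSpace ℝ (Fin n))} (hYc : Convex ℝ Y)
    {a₀ : ℝ} {y₀ : EuclideanSpace ℝ (Fin n)} {q : ℝ} (hq1 : 1 < q) (hq2 : q ≤ 2)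
    {γ : EuclideanSpace ℝ (Fin n) → ℝ} {Kγ : NNReal} (hγ : LipschitzWith Kγ γ)
    {lam : ℝ} (hlam : 0 < lam) (hγlb : ∀ x ∈ X, lam ≤ γ x) {u : EuclideanSpace ℝ (Fin n) → ℝ}
    {M : NNReal} (hM : 0 < M) (hYM : ∀ y ∈ closure Y, ‖y‖ ≤ M) (hulip : LipschitzWith M u)
    (hu : admissible X Y a₀ y₀ u)
    (hmin : ∀ v, admissible X Y a₀ y₀ v → rochetChone X γ q u ≤ rochetChone X γ q v)
    {δ : NNReal} (hδ : 0 < δ) :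
    ∃ C : ℝ, 0 ≤ C ∧ ∀ x₀, Metric.ball x₀ δ ⊆ X → ∀ p ∈ subgrad X u x₀, ∀ x₁ ∈ X,
      2 ^ (n + 4) * n * ‖x₁ - x₀‖ ≤ δ → u x₁ - u x₀ - ⟪p, x₁ - x₀⟫ ≤ C * ‖x₁ - x₀‖ ^ 2 := by
  obtain ⟨R, hR⟩ : ∃ R : NNReal, ∀ x ∈ X, ‖x‖ ≤ R := by
    obtain ⟨R, hR⟩ := hXb.exists_norm_le
    exact ⟨R.toNNReal, fun x hx => (hR x hx).trans (Real.le_coe_toNNReal R)⟩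
  obtain ⟨G, hG0, hG⟩ : ∃ G : NNReal, 0 < G ∧ ∀ x ∈ X, |γ x| ≤ G := by
    obtain ⟨G, hG⟩ := hXb.isCompact_closure.exists_bound_of_continuousOn hγ.continuous.continuousOn
    refine ⟨G.toNNReal + 1, by positivity, fun x hx => (hG x (subset_closure hx)).trans ?_⟩
    push_cast
    linarith [Real.le_coe_toNNReal G]
  set κ := (q - 1) / 2 * (M : ℝ) ^ (q - 2) * lam with hκ
  have hκ0 : 0 < κ := by
    have : 0 < q - 1 := by linarith
    have := Real.rpow_pos_of_pos (NNReal.coe_pos.2 hM) (q - 2)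
    positivity
  set D : NNReal := M ^ (q - 1) + R with hD
  set C₁ : ℝ := n * ((G + D * Kγ) + 2 * n * (G * D) / δ) + G with hC₁
  have hC₁0 : 0 < C₁ := by positivity
  refine ⟨C₁ / κ * (2 ^ (n + 3)) ^ 2, by positivity, fun x₀ hball p hp x₁ hx₁ hsmall => ?_⟩
  have hx₀ : x₀ ∈ X := hball (Metric.mem_ball_self hδ)
  obtain ⟨p₁, hp₁⟩ := hu.1.subgrad_nonempty hXo hx₁
  set h := u x₁ - u x₀ - ⟪p, x₁ - x₀⟫ with hh
  rcases le_or_gt h 0 with hneg | hpos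
  · exact hneg.trans (by positivity)
  obtain ⟨ξ, P, c, hξ, hPseg, hcx₀, hcap⟩ := exists_affine_cap hx₀ hp hp₁ hh hpos
  set r := ‖x₁ - x₀‖ with hr
  have hr0 : 0 < r := by
    refine norm_pos_iff.2 fun h0 => hpos.ne' ?_
    rw [hh, sub_eq_zero.1 h0]
    simp
  have hPY : P ∈ closure Y :=
    hYc.closure.segment_subset (hu.2.1 x₀ hx₀ hp) (hu.2.1 x₁ hx₁ hp₁) hPseg
  have hPM := hYM P hPY
  set w : EuclideanSpace ℝ (Fin n) → ℝ := fun x => max 0 (c + ⟪P, x⟫ - u x) with hw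
  have hwlip : LipschitzWith (‖P‖₊ + M) w :=
    ((lipschitzWith_const_add_inner c P).sub hulip).const_max 0
  have hw0 : ∀ x, 0 ≤ w x := fun x => le_max_left _ _
  have hwpos : ∀ x, 0 < w x ↔ u x < c + ⟪P, x⟫ := fun x => by
    rw [hw]
    simp
  set S := {x ∈ X | 0 < w x} with hS
  have hSX : S ⊆ X := fun x hx => hx.1
  have hSo : IsOpen S := hXo.inter (isOpen_lt continuous_const hwlip.continuous)
  have hSfin : volume S ≠ ⊤ := measure_ne_top_of_subset hSX hXb.measure_lt_top.ne
  have hwx₀ : w x₀ = h / 2 := by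
    simp only [hw]
    rw [hcx₀]
    exact max_eq_right (by linarith)
  have hx₀S : x₀ ∈ S := ⟨hx₀, by rw [hwx₀]; linarith⟩
  have hwh : ∀ x ∈ X, w x ≤ h := fun x hx => by
    rcases lt_or_ge (u x) (c + ⟪P, x⟫) with hlt | hge
    · exact max_le hpos.le (hcap x hx hlt).2
    · exact max_le hpos.le (by linarith)
  have hconc : ConcaveOn ℝ X (fun x => c + ⟪P, x⟫ - u x) := by
    refine ConcaveOn.sub ?_ hu.1
    exact (concaveOn_const c hXc).add ((innerSL ℝ P).toLinearMap.concaveOn hXc)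
  have hSc : Convex ℝ S := by
    have : S = {x ∈ X | 0 < c + ⟪P, x⟫ - u x} := by
      ext x
      simp only [hS, Set.mem_ofPred_eq, hwpos, sub_pos]
    rw [this]
    exact hconc.convex_gt 0
  have hwc : ConcaveOn ℝ S w :=
    (hconc.subset hSX hSc).congr fun x hx =>
      (max_eq_right (by linarith [(hwpos x).1 hx.2])).symm
  have henergy := setIntegral_norm_gradient_sq_le hXo hXb hq1 hq2 hγ.continuous hlam hγlb hM hulip
    hPM c (hmin _ (hu.sup_affine hXo hYc hPY c)) hw
  have hflux := setIntegral_inner_gradient_le hXo hXc hXb hδ hball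
    hγ.lipschitzOnWith hG (b := ‖P‖ ^ (q - 2) • P) (D := D) (fun x hx => by
      rw [hD]
      push_cast
      exact (norm_sub_le _ _).trans (add_le_add (norm_rpow_smul_le hq1 hPM) (hR x hx)))
    hwlip hw0 hS hSc hx₀S hwh
  have hmass : ∫ x in X, γ x * w x ≤ G * h * volume.real S := by
    rw [setIntegral_eq_of_subset_of_forall_sdiff_eq_zero hXo.measurableSet hSX]
    · refine (le_abs_self _).trans (norm_setIntegral_le_of_norm_le_const
        (f := fun x => γ x * w x) hSfin.lt_top fun x hx => ?_)
      rw [Real.norm_eq_abs, abs_mul, abs_of_nonneg (hw0 x)]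
      exact mul_le_mul (hG x hx.1) (hwh x hx.1) (hw0 x) G.2
    · rintro x ⟨hx, hxS⟩
      rw [le_antisymm (not_lt.1 fun h => hxS ⟨hx, h⟩) (hw0 x), mul_zero]
  have hpoinc := mul_volume_le_mul_setIntegral_norm_gradient hXo hXc hXb hδ hball hwlip hw0 hS hwc
    hx₀S hwh hwx₀.ge hξ (fun x hx => (hcap x hx.1 ((hwpos x).1 hx.2)).1) hsmall
  have hs0 : 0 < volume.real S :=
    ENNReal.toReal_pos (hSo.measure_pos volume ⟨x₀, hx₀S⟩).ne' hSfin
  have hA : ∫ x in X, ‖gradient w x‖ ^ 2 ≤ C₁ / κ * h * volume.real S := by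
    have : κ * ∫ x in X, ‖gradient w x‖ ^ 2 ≤ C₁ * h * volume.real S := by
      rw [← hκ] at henergy
      rw [hC₁, add_mul, add_mul]
      linarith
    rw [div_mul_eq_mul_div, div_mul_eq_mul_div, le_div_iff₀ hκ0]
    linarith
  set C₂ := C₁ / κ with hC₂
  have hC₂0 : 0 < C₂ := by positivity
  set N : ℝ := 2 ^ (n + 3) with hN
  have hN0 : 0 < N := by positivity
  have hyoung := setIntegral_norm_gradient_le_add hXo hXb hwlip hw0 hS
    (a := 1 / (N * C₂ * r)) (by positivity)
  set s := volume.real S with hs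
  have hchain : h / N * s ≤ h / N * s / 2 + N * C₂ * r ^ 2 / 2 * s := by
    calc h / N * s ≤ r * ∫ x in X, ‖gradient w x‖ := hpoinc
      _ ≤ r * (1 / (N * C₂ * r) / 2 * (C₂ * h * s) + s / (2 * (1 / (N * C₂ * r)))) := by
        refine mul_le_mul_of_nonneg_left (hyoung.trans ?_) hr0.le
        gcongr
      _ = _ := by field_simp
  have hfin : h / N ≤ N * C₂ * r ^ 2 := by
    refine le_of_mul_le_mul_right ?_ hs0
    linarith
  rw [div_le_iff₀ hN0] at hfin
  linarith

end Regularity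

section Main

variable {n : ℕ} {X Y : Set (EuclideanSpace ℝ (Fin n))} {u v : EuclideanSpace ℝ (Fin n) → ℝ}

theorem subgrad_congr (huv : Set.EqOn u v X) {x : EuclideanSpace ℝ (Fin n)} (hx : x ∈ X) :
    subgrad X u x = subgrad X v x := by
  ext p
  refine forall₂_congr fun z hz => ?_
  rw [huv hx, huv hz]

theorem admissible.congr {a₀ : ℝ} {y₀ : EuclideanSpace ℝ (Fin n)} (hu : admissible X Y a₀ y₀ u)
    (huv : Set.EqOn u v X) : admissible X Y a₀ y₀ v :=
  ⟨hu.1.congr huv, fun x hx => subgrad_congr huv hx ▸ hu.2.1 x hx,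
    fun x hx => huv hx ▸ hu.2.2 x hx⟩

theorem rochetChone_congr (hXo : IsOpen X) {γ γ' : EuclideanSpace ℝ (Fin n) → ℝ}
    (hγ : Set.EqOn γ γ' X) (huv : Set.EqOn u v X) (q : ℝ) :
    rochetChone X γ q u = rochetChone X γ' q v := by
  refine setIntegral_congr_fun hXo.measurableSet fun x hx => ?_
  have hg : gradient u x = gradient v x := by
    rw [gradient, (huv.eventuallyEq_of_mem (hXo.mem_nhds hx)).fderiv_eq, gradient]
  simp only [hg, hγ hx, huv hx]

/-- A convex function detaching at most quadratically from a supporting hyperplane is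
differentiable, with gradient the slope of that hyperplane. -/
theorem hasGradientAt_of_forall_sub_le {x p : EuclideanSpace ℝ (Fin n)} (hXo : IsOpen X)
    (hx : x ∈ X) (hp : p ∈ subgrad X u x) {C ρ : ℝ} (hρ : 0 < ρ)
    (h : ∀ z ∈ X, ‖z - x‖ ≤ ρ → u z - u x - ⟪p, z - x⟫ ≤ C * ‖z - x‖ ^ 2) :
    HasGradientAt u p x := by
  rw [hasGradientAt_iff_isLittleO]
  refine Asymptotics.IsBigO.trans_isLittleO (g := fun z => ‖z - x‖ ^ 2) ?_
    (Asymptotics.isLittleO_pow_sub_sub x one_lt_two)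
  refine Asymptotics.IsBigO.of_bound C ?_
  filter_upwards [hXo.mem_nhds hx, Metric.closedBall_mem_nhds x hρ] with z hz hzρ
  rw [Real.norm_of_nonneg (by linarith [hp z hz]), Real.norm_of_nonneg (by positivity)]
  exact h z hz (by rwa [← dist_eq_norm])

/-- Quadratic detachment from the supporting hyperplanes at `x` controls the variation of the
gradient between `x` and `y`. -/
theorem norm_sub_le_of_forall_sub_le {x y p p' : EuclideanSpace ℝ (Fin n)} {C : ℝ} (hy : y ∈ X)
    (hp : p ∈ subgrad X u x) (hp' : p' ∈ subgrad X u y)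
    (hball : Metric.closedBall x (2 * ‖x - y‖) ⊆ X) (hxy : x ≠ y)
    (h : ∀ z ∈ X, ‖z - x‖ ≤ 2 * ‖x - y‖ → u z - u x - ⟪p, z - x⟫ ≤ C * ‖z - x‖ ^ 2)
    (hC : 0 ≤ C) : ‖p - p'‖ ≤ 4 * C * ‖x - y‖ := by
  rcases eq_or_ne (p' - p) 0 with h0 | h0
  · rw [norm_sub_rev, h0, norm_zero]
    positivity
  have hg : 0 < ‖p' - p‖ := norm_pos_iff.2 h0
  have hd : 0 < ‖x - y‖ := norm_pos_iff.2 (sub_ne_zero.2 hxy)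
  set d := ‖x - y‖ with hdd
  set z := y + (d / ‖p' - p‖) • (p' - p) with hz
  have hzy : z - y = (d / ‖p' - p‖) • (p' - p) := by rw [hz]; abel
  have hzyn : ‖z - y‖ = d := by
    rw [hzy, norm_smul, Real.norm_of_nonneg (by positivity), div_mul_cancel₀ _ hg.ne']
  have hzx : ‖z - x‖ ≤ 2 * d := by
    calc ‖z - x‖ = ‖(z - y) - (x - y)‖ := by congr 1; abel
      _ ≤ ‖z - y‖ + ‖x - y‖ := norm_sub_le _ _
      _ = 2 * d := by rw [hzyn, ← hdd]; ring
  have hzX : z ∈ X := hball (by rwa [Metric.mem_closedBall, dist_eq_norm])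
  have h1 := h z hzX hzx
  have h2 := hp' z hzX
  have h3 := hp y hy
  have h4 : ⟪p', z - y⟫ - ⟪p, z - y⟫ = d * ‖p' - p‖ := by
    rw [← inner_sub_left, hzy, real_inner_smul_right, real_inner_self_eq_norm_sq]
    field_simp
  have h5 : ⟪p, z - x⟫ = ⟪p, z - y⟫ + ⟪p, y - x⟫ := by rw [← inner_add_right]; congr 1; abel
  have h6 : C * ‖z - x‖ ^ 2 ≤ C * (2 * d) ^ 2 := by gcongr
  rw [norm_sub_rev]
  refine le_of_mul_le_mul_left ?_ hd
  linarith

end Main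

/-- **Interior `C^{1,1}` regularity for the Rochet–Choné model with `q`-power cost,
`q > 2`** (Theorem 4.1, case `q > 2`). -/
theorem rochetChone_regularity_q_le_two {n : ℕ} (hn : 1 ≤ n)
    (X Y : Set (EuclideanSpace ℝ (Fin n)))
    (hXo : IsOpen X) (hXb : Bornology.IsBounded X)
    (hYo : IsOpen Y) (hYb : Bornology.IsBounded Y) (hYc : Convex ℝ Y)
    (a₀ : ℝ) (y₀ : EuclideanSpace ℝ (Fin n)) (hy₀ : y₀ ∈ Y)
    (q : ℝ) (hq1 : 1 < q) (hq2 : q ≤ 2)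
    (γ : EuclideanSpace ℝ (Fin n) → ℝ) (Kγ : NNReal) (hγlip : LipschitzOnWith Kγ γ X)
    (lam : ℝ) (hlam : 0 < lam) (hγlb : ∀ x ∈ X, lam ≤ γ x)
    (u : EuclideanSpace ℝ (Fin n) → ℝ) (hu : admissible X Y a₀ y₀ u)
    (hmin : ∀ v, admissible X Y a₀ y₀ v → rochetChone X γ q u ≤ rochetChone X γ q v) :
    (∀ x ∈ X, DifferentiableAt ℝ u x) ∧
      ∀ K : Set (EuclideanSpace ℝ (Fin n)), K ⊆ X → IsCompact K →
        ∃ C : ℝ, ∀ x ∈ K, ∀ y ∈ K,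
          ‖gradient u x - gradient u y‖ ≤ C * ‖x - y‖ := by
  obtain ⟨M, hM, hYM⟩ : ∃ M : NNReal, 0 < M ∧ ∀ y ∈ closure Y, ‖y‖ ≤ M := by
    obtain ⟨R, hR⟩ := hYb.closure.exists_norm_le
    refine ⟨R.toNNReal + 1, by positivity, fun y hy => (hR y hy).trans ?_⟩
    push_cast
    linarith [Real.le_coe_toNNReal R]
  obtain ⟨u', hu'lip, huu'⟩ := (hu.1.lipschitzOnWith_of_subgrad_norm_le hXo
    fun x hx p hp => hYM p (hu.2.1 x hx hp)).extend_real
  obtain ⟨γ', hγ'lip, hγγ'⟩ := hγlip.extend_real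
  have hmin' : ∀ v, admissible X Y a₀ y₀ v → rochetChone X γ' q u' ≤ rochetChone X γ' q v := by
    intro v hv
    rw [← rochetChone_congr hXo hγγ' huu', ← rochetChone_congr hXo hγγ' (Set.eqOn_refl v X)]
    exact hmin v hv
  have hquad : ∀ δ : NNReal, 0 < δ → ∃ C : ℝ, 0 ≤ C ∧ ∀ x, Metric.ball x δ ⊆ X →
      ∀ p ∈ subgrad X u x, ∀ z ∈ X, ‖z - x‖ ≤ δ / (2 ^ (n + 4) * n) →
        u z - u x - ⟪p, z - x⟫ ≤ C * ‖z - x‖ ^ 2 := by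
    intro δ hδ
    obtain ⟨C, hC, h⟩ := exists_forall_sub_le_mul_sq hXo hu.1.1 hXb hYc hq1 hq2 hγ'lip hlam
      (fun x hx => hγγ' hx ▸ hγlb x hx) hM hYM hu'lip (hu.congr huu') hmin' hδ
    refine ⟨C, hC, fun x hball p hp z hz hzx => ?_⟩
    have hx : x ∈ X := hball (Metric.mem_ball_self hδ)
    rw [huu' hx, huu' hz]
    refine h x hball p (subgrad_congr huu' hx ▸ hp) z hz ?_
    rwa [le_div_iff₀ (by positivity), mul_comm] at hzx
  have hgrad : ∀ x ∈ X, ∃ p ∈ subgrad X u x, HasGradientAt u p x := by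
    intro x hx
    obtain ⟨p, hp⟩ := hu.1.subgrad_nonempty hXo hx
    obtain ⟨ε, hε, hball⟩ := Metric.isOpen_iff.1 hXo x hx
    lift ε to NNReal using hε.le
    obtain ⟨C, hC, h⟩ := hquad ε hε
    have hn' : (0 : ℝ) < n := by exact_mod_cast hn
    exact ⟨p, hp, hasGradientAt_of_forall_sub_le hXo hx hp (by positivity) (h x hball p hp)⟩
  have hmem : ∀ x ∈ X, gradient u x ∈ subgrad X u x := by
    intro x hx
    obtain ⟨p, hp, hpg⟩ := hgrad x hx
    rwa [hpg.gradient]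
  refine ⟨fun x hx => ?_, fun K hKX hK => ?_⟩
  · obtain ⟨p, -, hpg⟩ := hgrad x hx
    exact hpg.differentiableAt
  obtain ⟨δ, hδ, hδX⟩ := hK.exists_thickening_subset_open hXo hKX
  lift δ to NNReal using hδ.le
  have hball : ∀ x ∈ K, Metric.ball x δ ⊆ X := fun x hx =>
    (Metric.ball_subset_thickening hx δ).trans hδX
  obtain ⟨C, hC, h⟩ := hquad δ hδ
  have hn' : (1 : ℝ) ≤ n := by exact_mod_cast hn
  set ρ : ℝ := δ / (2 ^ (n + 4) * n) with hρ
  have hρ0 : 0 < ρ := by positivity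
  have hρδ : ρ < δ := by
    refine div_lt_self hδ ?_
    have : (1 : ℝ) < 2 ^ (n + 4) := one_lt_pow₀ one_lt_two (by omega)
    nlinarith
  refine ⟨4 * C + 4 * M / ρ, fun x hx y hy => ?_⟩
  rcases eq_or_ne x y with rfl | hxy
  · simp
  rcases le_or_gt (2 * ‖x - y‖) ρ with hle | hgt
  · refine (norm_sub_le_of_forall_sub_le (hKX hy) (hmem x (hKX hx)) (hmem y (hKX hy))
      ((Metric.closedBall_subset_ball (hle.trans_lt hρδ)).trans (hball x hx)) hxy
      (fun z hz hzx => h x (hball x hx) _ (hmem x (hKX hx)) z hz (hzx.trans hle)) hC).trans ?_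
    gcongr
    exact le_add_of_nonneg_right (by positivity)
  · have hbound : ∀ x ∈ K, ‖gradient u x‖ ≤ M := fun x hx =>
      hYM _ (hu.2.1 x (hKX hx) (hmem x (hKX hx)))
    have h1 := (norm_sub_le _ _).trans (add_le_add (hbound x hx) (hbound y hy))
    have h2 : (M : ℝ) + M ≤ 4 * M / ρ * ‖x - y‖ := by
      rw [div_mul_eq_mul_div, le_div_iff₀ hρ0]
      have := mul_le_mul_of_nonneg_left hgt.le M.2
      simp only [NNReal.val_eq_coe] at this
      linarith
    refine h1.trans (h2.trans ?_)
    gcongr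
    exact le_add_of_nonneg_left (by positivity)
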